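/- arXiv:2311.09545 — 3 statements merged into one kernel-verified Lean document; each statement's English description precedes it below -/
import Mathlib

section
/- Suppose the pair (A,B) is controllable, the offline input sequence u_d(1),…,u_d(N_d) is persistently exciting of order L+n (where L = L_p + L_f), and (u_d, y_d) is a noise-free length-N_d input/output trajectory of the system. Then for every length-L input/output trajectory (ū, ȳ) of the system there exists a vector g ∈ ℝ^{N_d−L+1} such that H_L(u_d) g = ū and H_L(y_d) g = ȳ (Willems' fundamental lemma, existence of a data-driven representation). -/
open Matrix

/-- A length-`T` input/output trajectory of the LTI system
`x(t+1) = A x(t) + B u(t)`, `y(t) = C x(t) + D u(t)` (time starts at `t = 0`). -/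
def IsTrajectory {n mdim pdim : ℕ}
    (A : Matrix (Fin n) (Fin n) ℝ) (B : Matrix (Fin n) (Fin mdim) ℝ)
    (C : Matrix (Fin pdim) (Fin n) ℝ) (D : Matrix (Fin pdim) (Fin mdim) ℝ)
    (T : ℕ) (u : ℕ → Fin mdim → ℝ) (y : ℕ → Fin pdim → ℝ) : Prop :=
  ∃ x : ℕ → Fin n → ℝ, ∀ t, t < T →
    x (t + 1) = A.mulVec (x t) + B.mulVec (u t) ∧
    y t = C.mulVec (x t) + D.mulVec (u t)

/-- Block Hankel matrix of depth `s` built from the `Nd` data points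
`x(0), …, x(Nd − 1)`: the `(i, j)` block entry (each block in `ℝ^q`) is `x(i + j)`. -/
def hankel (q s Nd : ℕ) (x : ℕ → Fin q → ℝ) :
    Matrix (Fin s × Fin q) (Fin (Nd - s + 1)) ℝ :=
  fun r j => x ((r.1 : ℕ) + (j : ℕ)) r.2

/-- A sequence is persistently exciting of order `s` if its depth-`s` Hankel matrix
has full row rank. -/
def PersistentlyExciting (q s Nd : ℕ) (x : ℕ → Fin q → ℝ) : Prop :=
  (hankel q s Nd x).rank = q * s

/-- Controllability matrix `[B, AB, …, A^{n−1}B]`. -/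
def ctrbMatrix {n mdim : ℕ} (A : Matrix (Fin n) (Fin n) ℝ)
    (B : Matrix (Fin n) (Fin mdim) ℝ) : Matrix (Fin n) (Fin n × Fin mdim) ℝ :=
  fun i c => (A ^ (c.1 : ℕ) * B) i c.2

section Auxiliary

open Finset

section Rank

variable {ι κ : Type*} [Fintype ι] [Fintype κ]

theorem Matrix.eq_zero_of_vecMul_eq_zero_of_rank_eq {M : Matrix ι κ ℝ}
    (hM : M.rank = Fintype.card ι) {ξ : ι → ℝ} (hξ : ξ ᵥ* M = 0) : ξ = 0 := by
  have hli : LinearIndependent ℝ M.row := by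
    rw [linearIndependent_iff_card_eq_finrank_span, Set.finrank, ← rank_eq_finrank_span_row, hM]
  exact Matrix.vecMul_injective_iff.2 hli (by simpa using hξ)

theorem Matrix.mulVec_surjective_of_vecMul_eq_zero {M : Matrix ι κ ℝ}
    (hM : ∀ ξ, ξ ᵥ* M = 0 → ξ = 0) : Function.Surjective M.mulVec := by
  have hinj : Function.Injective M.vecMul :=
    (injective_iff_map_eq_zero M.vecMulLinear).2 hM
  have hrank := (Matrix.vecMul_injective_iff.1 hinj).rank_matrix
  have htop : LinearMap.range M.mulVecLin = ⊤ :=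
    Submodule.eq_top_of_finrank_eq (by simpa [Matrix.rank] using hrank)
  exact LinearMap.range_eq_top.1 htop

end Rank

/-- A sequence that vanishes eventually and satisfies a monic linear recurrence expressing each
term through later ones is zero. -/
theorem eq_zero_of_backward_recurrence {E : Type*} [AddCommGroup E] [Module ℝ E] {n S : ℕ}
    {c : ℕ → ℝ} {v : ℕ → E} (hc : c n = 1) (hv : ∀ t, S ≤ t → v t = 0)
    (hrec : ∀ t, ∑ k ∈ range (n + 1), c k • v (t + (n - k)) = 0) (t : ℕ) : v t = 0 := by
  refine Nat.strong_decreasing_induction (P := fun t => v t = 0)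
    ⟨S, fun t ht => hv t ht.le⟩ (fun t ih => ?_) t
  have h := hrec t
  rw [sum_range_succ, sum_eq_zero fun k hk => ?_] at h
  · simpa [hc] using h
  · rw [ih _ (by have := mem_range.1 hk; omega), smul_zero]

section Trajectory

variable {n m : ℕ} (A : Matrix (Fin n) (Fin n) ℝ) (B : Matrix (Fin n) (Fin m) ℝ)

/-- Coefficients of the input annihilator obtained from a state/input annihilator `(ξ, η)` by
eliminating the state over `n` shifts. -/
def shiftedAnnihilator (ξ : Fin n → ℝ) (η : ℕ → Fin m → ℝ) (t : ℕ) : Fin m → ℝ :=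
  if t < n then ξ ᵥ* (A ^ (n - 1 - t) * B) else η (t - n)

variable {A B} {L N : ℕ} {ξ : Fin n → ℝ} {η : ℕ → Fin m → ℝ}
  {x : ℕ → Fin n → ℝ} {u : ℕ → Fin m → ℝ}

theorem shifted_annihilation (hx : ∀ t, t < N → x (t + 1) = A *ᵥ x t + B *ᵥ u t)
    (h : ∀ j, j + L ≤ N → ξ ⬝ᵥ x j + ∑ t ∈ range L, η t ⬝ᵥ u (j + t) = 0) :
    ∀ k ≤ n, ∀ j, j + L + k ≤ N → (ξ ᵥ* A ^ k) ⬝ᵥ x j +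
      ∑ t ∈ range (L + k), shiftedAnnihilator A B ξ η (t + (n - k)) ⬝ᵥ u (j + t) = 0 := by
  intro k
  induction k with
  | zero => intro _ j hj; simpa [shiftedAnnihilator] using h j hj
  | succ k ih =>
    intro hk j hj
    have h₁ := ih (by omega) (j + 1) (by omega)
    have h₀ : shiftedAnnihilator A B ξ η (0 + (n - (k + 1))) = ξ ᵥ* (A ^ k * B) := by
      rw [shiftedAnnihilator, if_pos (by omega)]
      congr 3; omega
    rw [hx j (by omega)] at h₁
    rw [← add_assoc, sum_range_succ', h₀, add_zero]
    have hs : ∀ t, shiftedAnnihilator A B ξ η (t + 1 + (n - (k + 1))) ⬝ᵥ u (j + (t + 1)) =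
        shiftedAnnihilator A B ξ η (t + (n - k)) ⬝ᵥ u (j + 1 + t) := fun t => by
      rw [show t + 1 + (n - (k + 1)) = t + (n - k) by omega,
        show j + (t + 1) = j + 1 + t by omega]
    simp only [hs]
    rw [dotProduct_add, dotProduct_mulVec, dotProduct_mulVec, vecMul_vecMul, vecMul_vecMul,
      ← pow_succ] at h₁
    linarith

theorem PersistentlyExciting.eq_zero {q s : ℕ} {u w : ℕ → Fin q → ℝ}
    (hu : PersistentlyExciting q s N u)
    (hw : ∀ j, j < N - s + 1 → ∑ t ∈ range s, w t ⬝ᵥ u (j + t) = 0) (t : ℕ) (ht : t < s) :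
    w t = 0 := by
  have h := Matrix.eq_zero_of_vecMul_eq_zero_of_rank_eq (M := hankel q s N u)
    (ξ := fun r => w r.1 r.2) (by rw [hu]; simp [mul_comm]) (by
      ext j
      have := hw j j.2
      rw [sum_range] at this
      simpa [vecMul, dotProduct, hankel, Fintype.sum_prod_type, add_comm] using this)
  ext i
  exact congr_fun h (⟨t, ht⟩, i)

theorem eq_zero_of_ctrbMatrix_rank_eq (hctrb : (ctrbMatrix A B).rank = n)
    (h : ∀ k < n, ξ ᵥ* (A ^ k * B) = 0) : ξ = 0 := by
  refine Matrix.eq_zero_of_vecMul_eq_zero_of_rank_eq (by simpa using hctrb) ?_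
  ext c
  exact congr_fun (h c.1 c.1.2) c.2

theorem annihilator_eq_zero (hctrb : (ctrbMatrix A B).rank = n)
    (hu : PersistentlyExciting m (L + n) N u) (hN : L + n ≤ N)
    (hx : ∀ t, t < N → x (t + 1) = A *ᵥ x t + B *ᵥ u t) (hη : ∀ t, L ≤ t → η t = 0)
    (h : ∀ j, j + L ≤ N → ξ ⬝ᵥ x j + ∑ t ∈ range L, η t ⬝ᵥ u (j + t) = 0) :
    ξ = 0 ∧ η = 0 := by
  set v := shiftedAnnihilator A B ξ η with hv
  set c := A.charpoly.coeff
  have hv₀ : ∀ t, L + n ≤ t → v t = 0 := fun t ht => by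
    rw [hv, shiftedAnnihilator, if_neg (by omega), hη _ (by omega)]
  have hdeg : A.charpoly.natDegree = n := by simp [Matrix.charpoly_natDegree_eq_dim]
  have hcn : c n = 1 := by
    have := A.charpoly_monic.coeff_natDegree
    rwa [hdeg] at this
  have hCH : ∑ k ∈ range (n + 1), c k • A ^ k = 0 := by
    have := A.aeval_self_charpoly
    rwa [Polynomial.aeval_eq_sum_range, hdeg] at this
  have hrec : ∀ t, ∑ k ∈ range (n + 1), c k • v (t + (n - k)) = 0 := by
    intro t
    rcases lt_or_ge t (L + n) with ht | ht
    · refine hu.eq_zero (w := fun t => ∑ k ∈ range (n + 1), c k • v (t + (n - k)))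
        (fun j hj => ?_) t ht
      have hk : ∀ k ∈ range (n + 1), ∑ t ∈ range (L + n), v (t + (n - k)) ⬝ᵥ u (j + t) =
          -((ξ ᵥ* A ^ k) ⬝ᵥ x j) := fun k hk => by
        have hkn := mem_range.1 hk
        have := shifted_annihilation hx h k (by omega) j (by omega)
        rw [← sum_subset (range_subset_range.2 (show L + k ≤ L + n by omega)) fun t _ ht => ?_]
        · linarith
        · rw [hv₀ _ (by have := mem_range.not.1 ht; omega), zero_dotProduct]
      calc ∑ t ∈ range (L + n), (∑ k ∈ range (n + 1), c k • v (t + (n - k))) ⬝ᵥ u (j + t)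
          = ∑ k ∈ range (n + 1), c k * ∑ t ∈ range (L + n), v (t + (n - k)) ⬝ᵥ u (j + t) := by
            simp_rw [sum_dotProduct, smul_dotProduct, smul_eq_mul, mul_sum]
            exact sum_comm
        _ = -((ξ ᵥ* ∑ k ∈ range (n + 1), c k • A ^ k) ⬝ᵥ x j) := by
            rw [sum_congr rfl fun k hk' => by rw [hk k hk'], Matrix.vecMul_sum, sum_dotProduct,
              ← sum_neg_distrib]
            simp [vecMul_smul]
        _ = 0 := by simp [hCH]
    · exact sum_eq_zero fun k _ => by rw [hv₀ _ (by omega), smul_zero]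
  have hzero := eq_zero_of_backward_recurrence hcn hv₀ hrec
  constructor
  · refine eq_zero_of_ctrbMatrix_rank_eq hctrb fun k hk => ?_
    have := hzero (n - 1 - k)
    rwa [hv, shiftedAnnihilator, if_pos (by omega),
      show n - 1 - (n - 1 - k) = k by omega] at this
  · funext t
    simpa [hv, shiftedAnnihilator] using hzero (t + n)

/-- Under controllability and persistency of excitation, every initial state and input window is a
linear combination of the data windows. -/
theorem exists_state_input_combination (hctrb : (ctrbMatrix A B).rank = n)
    (hu : PersistentlyExciting m (L + n) N u) (hN : L + n ≤ N)
    (hx : ∀ t, t < N → x (t + 1) = A *ᵥ x t + B *ᵥ u t) (x₀ : Fin n → ℝ)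
    (w : ℕ → Fin m → ℝ) :
    ∃ g : Fin (N - L + 1) → ℝ, ∑ j, g j • x j = x₀ ∧
      ∀ t, t < L → ∑ j, g j • u (t + j) = w t := by
  let M : Matrix (Fin n ⊕ Fin L × Fin m) (Fin (N - L + 1)) ℝ :=
    fun r j => Sum.elim (fun i => x j i) (fun r => u (r.1 + j) r.2) r
  have hM : ∀ ζ, ζ ᵥ* M = 0 → ζ = 0 := by
    intro ζ hζ
    obtain ⟨h₁, h₂⟩ := annihilator_eq_zero (ξ := fun i => ζ (Sum.inl i))
      (η := fun t i => if ht : t < L then ζ (Sum.inr (⟨t, ht⟩, i)) else 0) hctrb hu hN hx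
      (fun t ht => by ext i; simp [ht.not_gt]) (fun j hj => by
        have := congr_fun hζ ⟨j, by omega⟩
        rw [sum_range]
        simpa [vecMul, dotProduct, M, Fintype.sum_prod_type, add_comm] using this)
    ext (i | ⟨t, i⟩)
    · exact congr_fun h₁ i
    · simpa using congr_fun (congr_fun h₂ t) i
  obtain ⟨g, hg⟩ := Matrix.mulVec_surjective_of_vecMul_eq_zero hM
    (Sum.elim x₀ fun r => w r.1 r.2)
  refine ⟨g, ?_, fun t ht => ?_⟩
  · ext i
    simpa [mulVec, dotProduct, M, mul_comm] using congr_fun hg (Sum.inl i)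
  · ext i
    simpa [mulVec, dotProduct, M, mul_comm] using congr_fun hg (Sum.inr (⟨t, ht⟩, i))

theorem PersistentlyExciting.le_length {q s : ℕ} {u : ℕ → Fin q → ℝ}
    (hu : PersistentlyExciting q s N u) (hq : 1 ≤ q) (hs : 2 ≤ s) : s ≤ N := by
  have h := (hankel q s N u).rank_le_card_width
  rw [hu, Fintype.card_fin] at h
  have : 2 ≤ q * s := by nlinarith
  omega

end Trajectory

theorem hankel_mulVec_apply {q s N : ℕ} (x : ℕ → Fin q → ℝ) (g : Fin (N - s + 1) → ℝ)
    (r : Fin s × Fin q) :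
    (hankel q s N x *ᵥ g) r = (∑ j, g j • x (r.1 + j)) r.2 := by
  simp [mulVec, dotProduct, hankel, mul_comm]

end Auxiliary

/-- Willems' fundamental lemma: existence of a data-driven representation of every
length-`L` trajectory, `L = Lp + Lf`. -/
theorem willems_fundamental_lemma
    (n mdim pdim Lp Lf Nd : ℕ) (hLp : 1 ≤ Lp) (hLf : 1 ≤ Lf)
    (A : Matrix (Fin n) (Fin n) ℝ) (B : Matrix (Fin n) (Fin mdim) ℝ)
    (C : Matrix (Fin pdim) (Fin n) ℝ) (D : Matrix (Fin pdim) (Fin mdim) ℝ)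
    (hctrb : (ctrbMatrix A B).rank = n)
    (ud : ℕ → Fin mdim → ℝ) (yd : ℕ → Fin pdim → ℝ)
    (hPE : PersistentlyExciting mdim (Lp + Lf + n) Nd ud)
    (hNd : Lp + Lf ≤ Nd)
    (hdata : IsTrajectory A B C D Nd ud yd) :
    ∀ (u : ℕ → Fin mdim → ℝ) (y : ℕ → Fin pdim → ℝ),
      IsTrajectory A B C D (Lp + Lf) u y →
      ∃ g : Fin (Nd - (Lp + Lf) + 1) → ℝ,
        (∀ r : Fin (Lp + Lf) × Fin mdim,
          (hankel mdim (Lp + Lf) Nd ud).mulVec g r = u r.1 r.2) ∧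
        (∀ r : Fin (Lp + Lf) × Fin pdim,
          (hankel pdim (Lp + Lf) Nd yd).mulVec g r = y r.1 r.2) := by
  intro u y ⟨x, hx⟩
  obtain ⟨xd, hxd⟩ := hdata
  have hN : Lp + Lf + n ≤ Nd := by
    rcases Nat.eq_zero_or_pos n with rfl | hn
    · simpa using hNd
    · refine hPE.le_length ?_ (by omega)
      have := (ctrbMatrix A B).rank_le_card_width
      rw [hctrb] at this
      by_contra hm
      have hm' : mdim = 0 := by omega
      simp [hm'] at this
      omega
  obtain ⟨g, hg₀, hgu⟩ := exists_state_input_combination hctrb hPE hN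
    (fun t ht => (hxd t ht).1) (x 0) u
  have hgx : ∀ t, t < Lp + Lf → ∑ j, g j • xd (t + j) = x t := by
    intro t
    induction t with
    | zero => intro _; simpa using hg₀
    | succ t ih =>
      intro ht
      rw [(hx t (by omega)).1, ← ih (by omega), ← hgu t (by omega), Matrix.mulVec_sum,
        Matrix.mulVec_sum, ← Finset.sum_add_distrib]
      refine Finset.sum_congr rfl fun j _ => ?_
      rw [show t + 1 + (j : ℕ) = t + j + 1 by omega, (hxd _ (by omega)).1, smul_add,
        mulVec_smul, mulVec_smul]
  refine ⟨g, fun r => ?_, fun r => ?_⟩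
  · rw [hankel_mulVec_apply, hgu _ r.1.2]
  · rw [hankel_mulVec_apply, (hx _ r.1.2).2, ← hgx _ r.1.2, ← hgu _ r.1.2, Matrix.mulVec_sum,
      Matrix.mulVec_sum, ← Finset.sum_add_distrib]
    refine congr_fun (Finset.sum_congr rfl fun j _ => ?_) r.2
    rw [(hxd _ (by omega)).2, smul_add, mulVec_smul, mulVec_smul]
end

section
/- Fix z_p ∈ ℝ^{(m+p)L_p}, arbitrary constraint sets 𝕌 ⊆ ℝ^{m L_f} and 𝕐 ⊆ ℝ^{p L_f}, and an arbitrary cost function J : ℝ^{m L_f} × ℝ^{p L_f} → ℝ. Define the feasible sets F₁ := {(u, ŷ) : u ∈ 𝕌, ŷ ∈ 𝕐, and there exists g ∈ ℝ^N with Z_p g = z_p, U_f g = u, Y_f g = ŷ, Q_3 g = 0} and F₂ := {(u, ŷ) : u ∈ 𝕌, ŷ ∈ 𝕐, ŷ = Y_f X col(z_p, u)}, where X := [Q_1; Q_2]ᵀ M^{-1} is the Moore–Penrose pseudoinverse of A := [Z_p; U_f]. Then F₁ = F₂; consequently a pair (u*, ŷ*) minimizes J over F₁ if and only if it minimizes J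 over F₂, and the optimal values of the two problems coincide. (Equivalence of γ-DDPC with hard constraint γ_3 = 0 and classical subspace predictive control.) -/
open Matrix

/-- Euclidean norm of a finite-dimensional real vector. -/
noncomputable def euclNorm {ι : Type*} [Fintype ι] (v : ι → ℝ) : ℝ :=
  Real.sqrt (∑ i, v i ^ 2)

/-- Frobenius norm of a real matrix. -/
noncomputable def frobNorm {ι κ : Type*} [Fintype ι] [Fintype κ] (X : Matrix ι κ ℝ) : ℝ :=
  Real.sqrt (∑ i, ∑ j, X i j ^ 2)

/-- Block lower-triangular part of a matrix viewed as an `Lf × Lf` array of `p × m`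
blocks: the (i,j) block is kept when `j ≤ i` and zeroed when `j > i`. -/
def blockLT {Lf p m : ℕ} (X : Matrix (Fin Lf × Fin p) (Fin Lf × Fin m) ℝ) :
    Matrix (Fin Lf × Fin p) (Fin Lf × Fin m) ℝ :=
  fun r c => if c.1 ≤ r.1 then X r c else 0

/-- For data `A = M * Q`, `Y = K * Q + L * R` with `M` invertible, `Q` having orthonormal rows and
`R` having rows orthogonal to those of `Q`, the outputs `Y *ᵥ g` of the solutions `g` of
`A *ᵥ g = w`, `R *ᵥ g = 0` are exactly the vector `Y * (Qᵀ * M⁻¹) *ᵥ w`. -/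
theorem exists_mulVec_eq_iff_of_orthonormal_rows {ι κ ο ν : Type*} [Fintype ι] [DecidableEq ι]
    [Fintype κ] [Fintype ν] {M : Matrix ι ι ℝ} {Q : Matrix ι ν ℝ} {R : Matrix κ ν ℝ}
    {K : Matrix ο ι ℝ} {L : Matrix ο κ ℝ} (hM : IsUnit M) (hQ : Q * Qᵀ = 1) (hRQ : R * Qᵀ = 0)
    (w : ι → ℝ) (y : ο → ℝ) :
    (∃ g : ν → ℝ, (M * Q) *ᵥ g = w ∧ (K * Q + L * R) *ᵥ g = y ∧ R *ᵥ g = 0) ↔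
      y = ((K * Q + L * R) * (Qᵀ * M⁻¹)) *ᵥ w := by
  have hdet : IsUnit M.det := (isUnit_iff_isUnit_det M).1 hM
  have hRX : R * (Qᵀ * M⁻¹) = 0 := by rw [← Matrix.mul_assoc, hRQ, Matrix.zero_mul]
  have hQX : Q * (Qᵀ * M⁻¹) = M⁻¹ := by rw [← Matrix.mul_assoc, hQ, Matrix.one_mul]
  constructor
  · rintro ⟨g, rfl, rfl, hR⟩
    have hY : (K * Q + L * R) * (Qᵀ * M⁻¹) = K * M⁻¹ := by
      rw [Matrix.add_mul, Matrix.mul_assoc, hQX, Matrix.mul_assoc, hRX, Matrix.mul_zero, add_zero]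
    rw [hY, mulVec_mulVec, Matrix.mul_assoc, nonsing_inv_mul_cancel_left _ _ hdet, add_mulVec,
      ← mulVec_mulVec g L, hR, mulVec_zero, add_zero]
  · rintro rfl
    refine ⟨(Qᵀ * M⁻¹) *ᵥ w, ?_, mulVec_mulVec _ _ _, ?_⟩
    · rw [mulVec_mulVec, Matrix.mul_assoc, hQX, mul_nonsing_inv _ hdet, one_mulVec]
    · rw [mulVec_mulVec, hRX, zero_mulVec]

theorem gammaDDPC_equiv_SPC
    (m p Lp Lf N : ℕ) (hm : 0 < m) (hp : 0 < p) (hLp : 0 < Lp) (hLf : 0 < Lf) (hN : 0 < N)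
    (Zp : Matrix (Fin ((m + p) * Lp)) (Fin N) ℝ)
    (Uf : Matrix (Fin Lf × Fin m) (Fin N) ℝ)
    (Yf : Matrix (Fin Lf × Fin p) (Fin N) ℝ)
    (L11 : Matrix (Fin ((m + p) * Lp)) (Fin ((m + p) * Lp)) ℝ)
    (L21 : Matrix (Fin Lf × Fin m) (Fin ((m + p) * Lp)) ℝ)
    (L22 : Matrix (Fin Lf × Fin m) (Fin Lf × Fin m) ℝ)
    (L31 : Matrix (Fin Lf × Fin p) (Fin ((m + p) * Lp)) ℝ)
    (L32 : Matrix (Fin Lf × Fin p) (Fin Lf × Fin m) ℝ)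
    (L33 : Matrix (Fin Lf × Fin p) (Fin Lf × Fin p) ℝ)
    (Q1 : Matrix (Fin ((m + p) * Lp)) (Fin N) ℝ)
    (Q2 : Matrix (Fin Lf × Fin m) (Fin N) ℝ)
    (Q3 : Matrix (Fin Lf × Fin p) (Fin N) ℝ)
    (hZp : Zp = L11 * Q1)
    (hUf : Uf = L21 * Q1 + L22 * Q2)
    (hYf : Yf = L31 * Q1 + L32 * Q2 + L33 * Q3)
    (hL11tri : ∀ i j : Fin ((m + p) * Lp), i < j → L11 i j = 0)
    (hL22tri : ∀ r c : Fin Lf × Fin m, r.1 < c.1 ∨ (r.1 = c.1 ∧ r.2 < c.2) → L22 r c = 0)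
    (hL33tri : ∀ r c : Fin Lf × Fin p, r.1 < c.1 ∨ (r.1 = c.1 ∧ r.2 < c.2) → L33 r c = 0)
    (hL11 : IsUnit L11) (hL22 : IsUnit L22) (hL33 : IsUnit L33)
    (hQ11 : Q1 * Q1ᵀ = 1) (hQ22 : Q2 * Q2ᵀ = 1) (hQ33 : Q3 * Q3ᵀ = 1)
    (hQ12 : Q1 * Q2ᵀ = 0) (hQ13 : Q1 * Q3ᵀ = 0) (hQ23 : Q2 * Q3ᵀ = 0)
    (zp : Fin ((m + p) * Lp) → ℝ)
    (𝕌 : Set (Fin Lf × Fin m → ℝ)) (𝕐 : Set (Fin Lf × Fin p → ℝ))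
    (J : (Fin Lf × Fin m → ℝ) → (Fin Lf × Fin p → ℝ) → ℝ) :
    let M := Matrix.fromBlocks L11 0 L21 L22
    let X := (Matrix.fromRows Q1 Q2)ᵀ * M⁻¹
    let F1 : Set ((Fin Lf × Fin m → ℝ) × (Fin Lf × Fin p → ℝ)) :=
      {q | q.1 ∈ 𝕌 ∧ q.2 ∈ 𝕐 ∧ ∃ g : Fin N → ℝ,
        Zp.mulVec g = zp ∧ Uf.mulVec g = q.1 ∧ Yf.mulVec g = q.2 ∧ Q3.mulVec g = 0}
    let F2 : Set ((Fin Lf × Fin m → ℝ) × (Fin Lf × Fin p → ℝ)) :=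
      {q | q.1 ∈ 𝕌 ∧ q.2 ∈ 𝕐 ∧ q.2 = (Yf * X).mulVec (Sum.elim zp q.1)}
    F1 = F2 ∧
      (∀ q, (q ∈ F1 ∧ ∀ q' ∈ F1, J q.1 q.2 ≤ J q'.1 q'.2) ↔
            (q ∈ F2 ∧ ∀ q' ∈ F2, J q.1 q.2 ≤ J q'.1 q'.2)) ∧
      sInf ((fun q => J q.1 q.2) '' F1) = sInf ((fun q => J q.1 q.2) '' F2) := by
  intro M X F1 F2
  have hM : IsUnit M := by
    rw [isUnit_iff_isUnit_det, det_fromBlocks_zero₁₂]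
    exact ((isUnit_iff_isUnit_det _).1 hL11).mul ((isUnit_iff_isUnit_det _).1 hL22)
  have hQ21 : Q2 * Q1ᵀ = 0 := by simpa using congrArg transpose hQ12
  have hQ31 : Q3 * Q1ᵀ = 0 := by simpa using congrArg transpose hQ13
  have hQ32 : Q3 * Q2ᵀ = 0 := by simpa using congrArg transpose hQ23
  have hQ : fromRows Q1 Q2 * (fromRows Q1 Q2)ᵀ = 1 := by
    rw [transpose_fromRows, fromRows_mul_fromCols, hQ11, hQ12, hQ21, hQ22, fromBlocks_one]
  have hRQ : Q3 * (fromRows Q1 Q2)ᵀ = 0 := by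
    rw [transpose_fromRows, mul_fromCols, hQ31, hQ32, fromCols_zero]
  have hY : Yf = fromCols L31 L32 * fromRows Q1 Q2 + L33 * Q3 := by
    rw [fromCols_mul_fromRows, hYf]
  have hA : M * fromRows Q1 Q2 = fromRows Zp Uf := by
    rw [fromBlocks_mul_fromRows, hZp, hUf, Matrix.zero_mul, add_zero]
  have hF : F1 = F2 := by
    ext q
    refine and_congr_right fun _ => and_congr_right fun _ => ?_
    rw [hY, ← exists_mulVec_eq_iff_of_orthonormal_rows hM hQ hRQ, hA]
    simp only [fromRows_mulVec, Sum.elim_eq_iff, and_assoc]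
  exact ⟨hF, fun q => by rw [hF], by rw [hF]⟩
end

section
/- Fix z_p ∈ ℝ^{(m+p)L_p}, arbitrary constraint sets 𝕌 ⊆ ℝ^{m L_f} and 𝕐 ⊆ ℝ^{p L_f}, an arbitrary cost function J : ℝ^{m L_f} × ℝ^{p L_f} → ℝ, and a weight μ ≥ 0. Let Π := [Q_1; Q_2]ᵀ [Q_1; Q_2]. Consider problem (I): minimize J(u, ŷ) + μ ‖γ_3‖² over u ∈ 𝕌, ŷ ∈ 𝕐 and vectors γ_1, γ_2, γ_3 subject to L_{11} γ_1 = z_p, L_{21} γ_1 + L_{22} γ_2 = u, L_{31} γ_1 + L_{32} γ_2 + L_{33} γ_3 = ŷ; and problem (II): minimize J(u, ŷ) + μ ‖(I − Π) g‖² over u ∈ 𝕌, ŷ ∈ 𝕐 and g ∈ ℝ^N subject to Z_p g = z_p, U_f g = u, Y_f g = ŷ. Then the two problems have equal optimal values, and a pair (u*, ŷ*) is the (u, ŷ)-component of an optimal solution of problem (I) if and only if it is the (u, ŷ)-component of an optimal solution of problem (II). (Equivalence of regularized γ-DDPC with Φ(γ) = ‖γ_3‖² and projection-regularized DDPC.)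 -/
open Matrix

theorem euclNorm_sq_eq_dotProduct {ι : Type*} [Fintype ι] (v : ι → ℝ) :
    euclNorm v ^ 2 = v ⬝ᵥ v := by
  rw [euclNorm, Real.sq_sqrt (Finset.sum_nonneg fun i _ => sq_nonneg (v i))]
  simp [dotProduct, sq]

section OrthonormalRows

variable {ι κ : Type*} [Fintype ι] [Fintype κ] [DecidableEq ι]

theorem mulVec_transpose_dotProduct_self {Q : Matrix ι κ ℝ} (hQ : Q * Qᵀ = 1) (v : ι → ℝ) :
    Qᵀ *ᵥ v ⬝ᵥ Qᵀ *ᵥ v = v ⬝ᵥ v := by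
  rw [mulVec_transpose, ← dotProduct_mulVec, ← mulVec_transpose, mulVec_mulVec, hQ, one_mulVec]

theorem euclNorm_transpose_mulVec_sq {Q : Matrix ι κ ℝ} (hQ : Q * Qᵀ = 1) (v : ι → ℝ) :
    euclNorm (Qᵀ *ᵥ v) ^ 2 = euclNorm v ^ 2 := by
  rw [euclNorm_sq_eq_dotProduct, euclNorm_sq_eq_dotProduct, mulVec_transpose_dotProduct_self hQ]

theorem euclNorm_mulVec_sq_le {Q : Matrix ι κ ℝ} (hQ : Q * Qᵀ = 1) (h : κ → ℝ) :
    euclNorm (Q *ᵥ h) ^ 2 ≤ euclNorm h ^ 2 := by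
  have hpos := sq_nonneg (euclNorm (h - Qᵀ *ᵥ (Q *ᵥ h)))
  have hcross : h ⬝ᵥ Qᵀ *ᵥ (Q *ᵥ h) = Q *ᵥ h ⬝ᵥ Q *ᵥ h := by
    rw [dotProduct_mulVec, vecMul_transpose]
  rw [euclNorm_sq_eq_dotProduct, sub_dotProduct, dotProduct_sub, dotProduct_sub,
    mulVec_transpose_dotProduct_self hQ, dotProduct_comm (Qᵀ *ᵥ (Q *ᵥ h)) h, hcross] at hpos
  rw [euclNorm_sq_eq_dotProduct, euclNorm_sq_eq_dotProduct]
  linarith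

end OrthonormalRows

/-- Mutually cofinal (from below) sets of reals have the same infimum, including the
unbounded and empty cases. -/
theorem Real.sInf_eq_of_subset_of_forall_exists_le {S T : Set ℝ} (hST : S ⊆ T)
    (hTS : ∀ t ∈ T, ∃ s ∈ S, s ≤ t) : sInf S = sInf T := by
  have hlb : lowerBounds S = lowerBounds T :=
    Set.Subset.antisymm
      (fun _ hb t ht => let ⟨_, hs, hst⟩ := hTS t ht; (hb hs).trans hst)
      (lowerBounds_mono_set hST)
  rcases S.eq_empty_or_nonempty with rfl | hS
  · have hT : T = ∅ := Set.eq_empty_of_forall_notMem fun t ht =>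
      let ⟨_, hs, _⟩ := hTS t ht; hs
    rw [hT]
  by_cases hb : BddBelow S
  · have hT : BddBelow T := by rwa [BddBelow, ← hlb]
    have h := isGLB_csInf hS hb
    rw [IsGLB, hlb] at h
    exact h.unique (isGLB_csInf (hS.mono hST) hT)
  · have hT : ¬ BddBelow T := by rwa [BddBelow, ← hlb]
    rw [Real.sInf_of_not_bddBelow hb, Real.sInf_of_not_bddBelow hT]

theorem regularized_gammaDDPC_equiv_projection_RDDPC
    (m p Lp Lf N : ℕ) (hm : 0 < m) (hp : 0 < p) (hLp : 0 < Lp) (hLf : 0 < Lf) (hN : 0 < N)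
    (Zp : Matrix (Fin ((m + p) * Lp)) (Fin N) ℝ)
    (Uf : Matrix (Fin Lf × Fin m) (Fin N) ℝ)
    (Yf : Matrix (Fin Lf × Fin p) (Fin N) ℝ)
    (L11 : Matrix (Fin ((m + p) * Lp)) (Fin ((m + p) * Lp)) ℝ)
    (L21 : Matrix (Fin Lf × Fin m) (Fin ((m + p) * Lp)) ℝ)
    (L22 : Matrix (Fin Lf × Fin m) (Fin Lf × Fin m) ℝ)
    (L31 : Matrix (Fin Lf × Fin p) (Fin ((m + p) * Lp)) ℝ)
    (L32 : Matrix (Fin Lf × Fin p) (Fin Lf × Fin m) ℝ)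
    (L33 : Matrix (Fin Lf × Fin p) (Fin Lf × Fin p) ℝ)
    (Q1 : Matrix (Fin ((m + p) * Lp)) (Fin N) ℝ)
    (Q2 : Matrix (Fin Lf × Fin m) (Fin N) ℝ)
    (Q3 : Matrix (Fin Lf × Fin p) (Fin N) ℝ)
    (hZp : Zp = L11 * Q1)
    (hUf : Uf = L21 * Q1 + L22 * Q2)
    (hYf : Yf = L31 * Q1 + L32 * Q2 + L33 * Q3)
    (hL11tri : ∀ i j : Fin ((m + p) * Lp), i < j → L11 i j = 0)
    (hL22tri : ∀ r c : Fin Lf × Fin m, r.1 < c.1 ∨ (r.1 = c.1 ∧ r.2 < c.2) → L22 r c = 0)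
    (hL33tri : ∀ r c : Fin Lf × Fin p, r.1 < c.1 ∨ (r.1 = c.1 ∧ r.2 < c.2) → L33 r c = 0)
    (hL11 : IsUnit L11) (hL22 : IsUnit L22) (hL33 : IsUnit L33)
    (hQ11 : Q1 * Q1ᵀ = 1) (hQ22 : Q2 * Q2ᵀ = 1) (hQ33 : Q3 * Q3ᵀ = 1)
    (hQ12 : Q1 * Q2ᵀ = 0) (hQ13 : Q1 * Q3ᵀ = 0) (hQ23 : Q2 * Q3ᵀ = 0)
    (zp : Fin ((m + p) * Lp) → ℝ)
    (𝕌 : Set (Fin Lf × Fin m → ℝ)) (𝕐 : Set (Fin Lf × Fin p → ℝ))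
    (J : (Fin Lf × Fin m → ℝ) → (Fin Lf × Fin p → ℝ) → ℝ)
    (μ : ℝ) (hμ : 0 ≤ μ) :
    let P := (Matrix.fromRows Q1 Q2)ᵀ * Matrix.fromRows Q1 Q2
    let feasI : (Fin Lf × Fin m → ℝ) → (Fin Lf × Fin p → ℝ) →
        (Fin ((m + p) * Lp) → ℝ) → (Fin Lf × Fin m → ℝ) → (Fin Lf × Fin p → ℝ) → Prop :=
      fun u yh γ1 γ2 γ3 => u ∈ 𝕌 ∧ yh ∈ 𝕐 ∧ L11.mulVec γ1 = zp ∧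
        L21.mulVec γ1 + L22.mulVec γ2 = u ∧
        L31.mulVec γ1 + L32.mulVec γ2 + L33.mulVec γ3 = yh
    let feasII : (Fin Lf × Fin m → ℝ) → (Fin Lf × Fin p → ℝ) → (Fin N → ℝ) → Prop :=
      fun u yh g => u ∈ 𝕌 ∧ yh ∈ 𝕐 ∧ Zp.mulVec g = zp ∧ Uf.mulVec g = u ∧ Yf.mulVec g = yh
    sInf {v : ℝ | ∃ u yh γ1 γ2 γ3, feasI u yh γ1 γ2 γ3 ∧ v = J u yh + μ * euclNorm γ3 ^ 2} =
      sInf {v : ℝ | ∃ u yh g, feasII u yh g ∧ v = J u yh + μ * euclNorm ((1 - P).mulVec g) ^ 2} ∧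
    ∀ (ustar : Fin Lf × Fin m → ℝ) (yhstar : Fin Lf × Fin p → ℝ),
      (∃ γ1 γ2 γ3, feasI ustar yhstar γ1 γ2 γ3 ∧
        ∀ u yh γ1' γ2' γ3', feasI u yh γ1' γ2' γ3' →
          J ustar yhstar + μ * euclNorm γ3 ^ 2 ≤ J u yh + μ * euclNorm γ3' ^ 2) ↔
      (∃ g, feasII ustar yhstar g ∧
        ∀ u yh g', feasII u yh g' →
          J ustar yhstar + μ * euclNorm ((1 - P).mulVec g) ^ 2 ≤
            J u yh + μ * euclNorm ((1 - P).mulVec g') ^ 2) := by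
  intro P feasI feasII
  have hQ21 : Q2 * Q1ᵀ = 0 := by simpa using congrArg transpose hQ12
  have hQ31 : Q3 * Q1ᵀ = 0 := by simpa using congrArg transpose hQ13
  have hQ32 : Q3 * Q2ᵀ = 0 := by simpa using congrArg transpose hQ23
  have hP : P = Q1ᵀ * Q1 + Q2ᵀ * Q2 := by
    simp only [P, transpose_fromRows, fromCols_mul_fromRows]
  have lift : ∀ u yh γ1 γ2 γ3, feasI u yh γ1 γ2 γ3 → ∃ g, feasII u yh g ∧
      euclNorm ((1 - P).mulVec g) ^ 2 = euclNorm γ3 ^ 2 := by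
    rintro u yh γ1 γ2 γ3 ⟨hu, hy, h1, h2, h3⟩
    set g := Q1ᵀ *ᵥ γ1 + Q2ᵀ *ᵥ γ2 + Q3ᵀ *ᵥ γ3 with hg
    have e1 : Q1 *ᵥ g = γ1 := by simp [hg, mulVec_add, hQ11, hQ12, hQ13]
    have e2 : Q2 *ᵥ g = γ2 := by simp [hg, mulVec_add, hQ21, hQ22, hQ23]
    have e3 : Q3 *ᵥ g = γ3 := by simp [hg, mulVec_add, hQ31, hQ32, hQ33]
    refine ⟨g, ⟨hu, hy, ?_, ?_, ?_⟩, ?_⟩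
    · rw [hZp, ← mulVec_mulVec, e1, h1]
    · rw [hUf, add_mulVec, ← mulVec_mulVec, ← mulVec_mulVec, e1, e2, h2]
    · rw [hYf, add_mulVec, add_mulVec, ← mulVec_mulVec, ← mulVec_mulVec, ← mulVec_mulVec,
        e1, e2, e3, h3]
    · have hres : (1 - P) *ᵥ g = Q3ᵀ *ᵥ γ3 := by
        rw [sub_mulVec, one_mulVec, hP, add_mulVec, ← mulVec_mulVec, ← mulVec_mulVec, e1, e2, hg,
          add_sub_cancel_left]
      rw [hres, euclNorm_transpose_mulVec_sq hQ33]
  have descend : ∀ u yh g, feasII u yh g → ∃ γ1 γ2 γ3, feasI u yh γ1 γ2 γ3 ∧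
      euclNorm γ3 ^ 2 ≤ euclNorm ((1 - P).mulVec g) ^ 2 := by
    rintro u yh g ⟨hu, hy, h1, h2, h3⟩
    refine ⟨Q1 *ᵥ g, Q2 *ᵥ g, Q3 *ᵥ g, ⟨hu, hy, ?_, ?_, ?_⟩, ?_⟩
    · rw [mulVec_mulVec, ← hZp, h1]
    · rw [mulVec_mulVec, mulVec_mulVec, ← add_mulVec, ← hUf, h2]
    · rw [mulVec_mulVec, mulVec_mulVec, mulVec_mulVec, ← add_mulVec, ← add_mulVec, ← hYf, h3]
    · have hres : Q3 *ᵥ ((1 - P) *ᵥ g) = Q3 *ᵥ g := by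
        rw [mulVec_mulVec, hP, Matrix.mul_sub, Matrix.mul_add, ← Matrix.mul_assoc,
          ← Matrix.mul_assoc, hQ31, hQ32]
        simp
      rw [← hres]
      exact euclNorm_mulVec_sq_le hQ33 _
  refine ⟨Real.sInf_eq_of_subset_of_forall_exists_le ?_ ?_, fun us ys => ⟨?_, ?_⟩⟩
  · rintro _ ⟨u, yh, γ1, γ2, γ3, hf, rfl⟩
    obtain ⟨g, hg, hn⟩ := lift _ _ _ _ _ hf
    exact ⟨u, yh, g, hg, by rw [hn]⟩
  · rintro _ ⟨u, yh, g, hf, rfl⟩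
    obtain ⟨γ1, γ2, γ3, hγ, hn⟩ := descend _ _ _ hf
    exact ⟨_, ⟨u, yh, γ1, γ2, γ3, hγ, rfl⟩, by gcongr⟩
  · rintro ⟨γ1, γ2, γ3, hf, hopt⟩
    obtain ⟨g, hg, hn⟩ := lift _ _ _ _ _ hf
    refine ⟨g, hg, fun u yh g' hg' => ?_⟩
    obtain ⟨γ1', γ2', γ3', hγ', hn'⟩ := descend _ _ _ hg'
    rw [hn]
    exact (hopt _ _ _ _ _ hγ').trans (by gcongr)
  · rintro ⟨g, hf, hopt⟩
    obtain ⟨γ1, γ2, γ3, hγ, hn⟩ := descend _ _ _ hf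
    refine ⟨γ1, γ2, γ3, hγ, fun u yh γ1' γ2' γ3' hγ' => ?_⟩
    obtain ⟨g', hg', hn'⟩ := lift _ _ _ _ _ hγ'
    rw [← hn']
    exact le_trans (by gcongr) (hopt _ _ _ hg')
end
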